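/- arXiv:0711.0312 — 2 statements merged into one kernel-verified Lean document; each statement's English description precedes it below -/
import Mathlib

section
/- (Rényi, exact form) For every positive integer n, the number of connected mappings satisfies |U_n| = Σ_{k=1}^n C(n,k) · (k−1)! · k · n^{n−1−k}. -/
open scoped Classical
open Function

namespace IterMap

noncomputable section

/-- A vertex `v` is cyclic for `f` if some positive iterate of `f` fixes `v`. -/
def IsCyclic {n : ℕ} (f : Fin n → Fin n) (v : Fin n) : Prop :=
  ∃ t, 0 < t ∧ f^[t] v = v

theorem isCyclic_apply {n : ℕ} {f : Fin n → Fin n} {v : Fin n} (h : IsCyclic f v) :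
    IsCyclic f (f v) := by
  obtain ⟨t, ht, hv⟩ := h
  refine ⟨t, ht, ?_⟩
  calc f^[t] (f v) = f^[t + 1] v := (Function.iterate_succ_apply f t v).symm
    _ = f (f^[t] v) := Function.iterate_succ_apply' f t v
    _ = f v := by rw [hv]

/-- The permutation induced by `f` on its cyclic vertices. -/
def cyclicPerm {n : ℕ} (f : Fin n → Fin n) :
    Equiv.Perm {v : Fin n // IsCyclic f v} :=
  Equiv.ofBijective (fun v => ⟨f v.1, isCyclic_apply v.2⟩) (by
    rw [← Finite.injective_iff_bijective]
    intro u v huv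
    have h1 : f u.1 = f v.1 := congrArg Subtype.val huv
    obtain ⟨s, hs, hsu⟩ := u.2
    obtain ⟨t, ht, htv⟩ := v.2
    have hu : f^[s * t] u.1 = u.1 := by
      rw [Function.iterate_mul]
      exact Function.iterate_fixed hsu t
    have hv : f^[s * t] v.1 = v.1 := by
      rw [mul_comm, Function.iterate_mul]
      exact Function.iterate_fixed htv s
    have hst : 0 < s * t := Nat.mul_pos hs ht
    obtain ⟨k, hk⟩ : ∃ k, s * t = k + 1 := ⟨s * t - 1, by omega⟩
    apply Subtype.ext
    calc u.1 = f^[s * t] u.1 := hu.symm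
      _ = f^[k] (f u.1) := by rw [hk, Function.iterate_succ_apply]
      _ = f^[k] (f v.1) := by rw [h1]
      _ = f^[s * t] v.1 := by rw [hk, Function.iterate_succ_apply]
      _ = v.1 := hv)

/-- `T f`: the (eventual) period of the sequence of iterates of `f`. -/
def T {n : ℕ} (f : Fin n → Fin n) : ℕ :=
  sInf {T : ℕ | 0 < T ∧ ∀ m, n ≤ m → f^[m + T] = f^[m]}

/-- `B f`: the product of the lengths of the cycles of `f`. -/
def B {n : ℕ} (f : Fin n → Fin n) : ℕ :=
  (cyclicPerm f).cycleType.prod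

/-- `Z f`: the number of cyclic vertices of `f`. -/
def Z {n : ℕ} (f : Fin n → Fin n) : ℕ :=
  Nat.card {v : Fin n // IsCyclic f v}

/-- `O f`: the number of distinct positive iterates of `f`. -/
def O {n : ℕ} (f : Fin n → Fin n) : ℕ :=
  Nat.card {g : Fin n → Fin n // ∃ t, 0 < t ∧ g = f^[t]}

/-- `f` is connected if its functional graph has one weak component. -/
def Connected {n : ℕ} (f : Fin n → Fin n) : Prop :=
  ∀ u v : Fin n, ∃ s t : ℕ, f^[s] u = f^[t] v

/-- The set of connected mappings on `[n]`. -/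
def Un (n : ℕ) : Finset (Fin n → Fin n) :=
  Finset.univ.filter fun f => Connected f

/-- `kappa n`: the average cycle length of a uniform random connected mapping. -/
def kappa (n : ℕ) : ℝ :=
  (∑ f ∈ Un n, (Z f : ℝ)) / (Un n).card

def c (d : ℕ) : ℝ :=
  ((kappa d - 1) / d) * Real.exp (-(d : ℝ)) *
    ∑ k ∈ Finset.range d, (d : ℝ) ^ k / (k.factorial : ℝ)

def F (z : ℝ) : ℝ := (1 / (1 - z)) * Real.exp (∑' d : ℕ, c d * z ^ d)

def mu (m : ℕ) : ℝ := iteratedDeriv m F 0 / (m.factorial : ℝ)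

def g (s : ℝ) : ℝ := ∑' d : ℕ, c d * Real.exp (-(d : ℝ) * s)

/-- `M m`: the average order of a uniform random permutation of `[m]`. -/
def M (m : ℕ) : ℝ :=
  (∑ σ : Equiv.Perm (Fin m), (orderOf σ : ℝ)) / (m.factorial : ℝ)

def I : ℝ :=
  ∫ t in Set.Ioi (0 : ℝ), Real.log (Real.log (Real.exp 1 / (1 - Real.exp (-t))))

def beta0 : ℝ := Real.sqrt (8 * I)

def k0 : ℝ := (3 / 2) * (3 * I) ^ ((2 : ℝ) / 3)

end

inductive Reach {V : Type} (S : Finset V) (g : {v // v ∉ S} → V) : V → Prop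
  | base (v : V) (h : v ∈ S) : Reach S g v
  | step (v : V) (h : v ∉ S) (h' : Reach S g (g ⟨v, h⟩)) : Reach S g v

noncomputable def NF (V : Type) (S : Finset V) : ℕ :=
  Nat.card {g : {v // v ∉ S} → V // ∀ v, Reach S g v}

noncomputable def glue {V : Type} (S : Finset V) (T : Finset {v // v ∉ S})
    (a : {v // v ∈ T} → {v // v ∈ S}) (h : {v // v ∉ T} → {v // v ∉ S}) : {v // v ∉ S} → V :=
  fun v => if hv : v ∈ T then (a ⟨v, hv⟩ : V) else (h ⟨v, hv⟩ : V)

theorem glue_mem {V : Type} (S : Finset V) (T : Finset {v // v ∉ S})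
    (a : {v // v ∈ T} → {v // v ∈ S}) (h : {v // v ∉ T} → {v // v ∉ S}) (v : {v // v ∉ S}) :
    glue S T a h v ∈ S ↔ v ∈ T := by
  unfold glue
  split_ifs with hv
  · simp [hv]
  · simp only [hv, iff_false]; exact (h ⟨v, hv⟩).2

theorem reach_glue {V : Type} (S : Finset V) (T : Finset {v // v ∉ S})
    (a : {v // v ∈ T} → {v // v ∈ S}) (h : {v // v ∉ T} → {v // v ∉ S})
    (H : ∀ v, Reach T h v) (v : V) : Reach S (glue S T a h) v := by
  have key : ∀ v : {v // v ∉ S}, Reach T h v → Reach S (glue S T a h) v := by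
    intro v hv
    induction hv with
    | base v hv => exact .step _ v.2 (.base _ ((glue_mem S T a h v).2 hv))
    | step v hv _ ih =>
      refine .step _ v.2 ?_
      have : glue S T a h v = h ⟨v, hv⟩ := by simp [glue, hv]
      rw [Subtype.coe_eta, this]; exact ih
  by_cases hv : v ∈ S
  · exact .base _ hv
  · exact key ⟨v, hv⟩ (H _)

theorem reach_unglue {V : Type} (S : Finset V) (T : Finset {v // v ∉ S})
    (a : {v // v ∈ T} → {v // v ∈ S}) (h : {v // v ∉ T} → {v // v ∉ S})
    (H : ∀ v, Reach S (glue S T a h) v) (v : {v // v ∉ S}) : Reach T h v := by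
  have key : ∀ w : V, Reach S (glue S T a h) w → ∀ hw : w ∉ S, Reach T h ⟨w, hw⟩ := by
    intro w hw
    induction hw with
    | base w hw => intro h; exact absurd hw h
    | step w hw _ ih =>
      intro _
      by_cases hT : (⟨w, hw⟩ : {v // v ∉ S}) ∈ T
      · exact .base _ hT
      · refine .step _ hT ?_
        have := ih (fun h' => hT ((glue_mem S T a h _).1 h'))
        convert this using 1
        apply Subtype.ext
        simp [glue, hT]
  exact key v (H v) v.2

noncomputable def TT {V : Type} [Fintype V] (S : Finset V) (g : {v // v ∉ S} → V) :
    Finset {v // v ∉ S} := Finset.univ.filter fun v => g v ∈ S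

theorem NF_fiber {V : Type} [Fintype V] (S : Finset V) (T : Finset {v // v ∉ S}) :
    Nat.card {g : {g : {v // v ∉ S} → V // ∀ v, Reach S g v} // TT S g.1 = T}
      = S.card ^ T.card * NF {v // v ∉ S} T := by
  have e : Nat.card ({v // v ∈ T} → {v // v ∈ S}) = S.card ^ T.card := by
    simp [Nat.card_eq_fintype_card]
  rw [← e, NF, ← Nat.card_prod]
  symm
  apply Nat.card_eq_of_bijective (fun p => ⟨⟨glue S T p.1 p.2.1, reach_glue S T p.1 p.2.1 p.2.2⟩, by
    ext v; simp only [TT, Finset.mem_filter, Finset.mem_univ, true_and, glue_mem]⟩)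
  constructor
  · rintro ⟨a, h, hh⟩ ⟨a', h', hh'⟩ heq
    have heq' : glue S T a h = glue S T a' h' := congrArg (fun x => x.1.1) heq
    have h1 : a = a' := by
      funext ⟨v, hv⟩
      have := congrFun heq' v
      simp only [glue, hv, dite_true] at this
      exact Subtype.ext this
    have h2 : h = h' := by
      funext ⟨v, hv⟩
      have := congrFun heq' v
      simp only [glue, hv, dite_false] at this
      exact Subtype.ext this
    subst h1 h2; rfl
  · rintro ⟨⟨g, hg⟩, hT⟩
    have hm : ∀ v, v ∈ T ↔ g v ∈ S := by
      intro v; rw [← hT]; simp [TT]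
    have hgl : glue S T (fun v => ⟨g v.1, (hm _).1 v.2⟩)
        (fun v => ⟨g v.1, fun h => v.2 ((hm _).2 h)⟩) = g := by
      funext v; simp [glue]
    refine ⟨(fun v => ⟨g v.1, (hm _).1 v.2⟩, ⟨fun v => ⟨g v.1, fun h => v.2 ((hm _).2 h)⟩, ?_⟩), ?_⟩
    · apply reach_unglue S T (fun v => ⟨g v.1, (hm _).1 v.2⟩)
      rw [hgl]; exact hg
    · apply Subtype.ext; apply Subtype.ext; exact hgl

theorem card_fibers {A B : Type} [Finite A] [Fintype B] (f : A → B) :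
    Nat.card A = ∑ b, Nat.card {a // f a = b} := by
  rw [← Nat.card_sigma]
  exact Nat.card_congr (Equiv.sigmaFiberEquiv f).symm

theorem NF_rec {V : Type} [Fintype V] (S : Finset V) :
    NF V S = ∑ T : Finset {v // v ∉ S}, S.card ^ T.card * NF {v // v ∉ S} T := by
  rw [NF, card_fibers (fun g : {g : {v // v ∉ S} → V // ∀ v, Reach S g v} => TT S g.1)]
  exact Finset.sum_congr rfl fun T _ => NF_fiber S T

theorem abel_sum (m k : ℕ) (hm : 0 < m) :
    ∑ j ∈ Finset.range (m + 1), m.choose j * (k ^ j * (j * m ^ (m - j))) = k * m * (k + m) ^ (m - 1) := by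
  obtain ⟨p, rfl⟩ : ∃ p, m = p + 1 := ⟨m - 1, by omega⟩
  rw [Finset.sum_range_succ', add_pow k (p + 1), Finset.mul_sum]
  simp only [zero_mul, mul_zero, add_zero, Nat.add_sub_cancel]
  refine Finset.sum_congr rfl fun j _ => ?_
  have := Nat.add_one_mul_choose_eq p j
  rw [Nat.add_sub_add_right]
  calc _ = ((p+1).choose (j+1) * (j+1)) * (k^(j+1) * (p+1)^(p-j)) := by ring
    _ = _ := by rw [← this]; simp only [Nat.cast_id]; ring

theorem NF_formula (n : ℕ) : ∀ (V : Type) [Fintype V] (S : Finset V), Fintype.card V = n →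
    NF V S * n = S.card * n ^ (n - S.card) := by
  induction n using Nat.strong_induction_on with
  | _ n ih =>
  intro V _ S hV
  have hSn : S.card ≤ n := hV ▸ S.card_le_univ
  rcases Nat.eq_zero_or_pos n with rfl | hn
  · simp; omega
  rcases Nat.eq_zero_or_pos S.card with h0 | hk
  · obtain rfl : S = ∅ := by simpa using h0
    have : NF V ∅ = 0 := by
      rw [NF]
      have : Nonempty V := Fintype.card_pos_iff.1 (by omega)
      refine @Nat.card_of_isEmpty _ ⟨fun ⟨g, hg⟩ => ?_⟩
      obtain ⟨v⟩ := this
      have := hg v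
      induction this with
      | base v h => simp at h
      | step _ _ _ ih => exact ih
    simp [this]
  have hc : Fintype.card {v // v ∉ S} = n - S.card := by
    rw [Fintype.card_subtype_compl]; simp [hV]
  rcases Nat.eq_zero_or_pos (n - S.card) with hm | hm
  · have : NF V S = 1 := by
      rw [NF]
      rw [hm] at hc
      have : IsEmpty {v // v ∉ S} := Fintype.card_eq_zero_iff.1 hc
      rw [Nat.card_eq_one_iff_unique]
      refine ⟨⟨fun a b => Subtype.ext (Subsingleton.elim _ _)⟩, ⟨⟨fun v => isEmptyElim v, fun v => .base _ ?_⟩⟩⟩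
      by_contra h
      exact this.false ⟨v, h⟩
    rw [this, hm]; simp; omega
  · set m := n - S.card with hmdef
    have ih' := fun T => ih m (by omega) {v // v ∉ S} T hc
    apply Nat.eq_of_mul_eq_mul_left hm
    have : NF V S * m = S.card * m * n ^ (m - 1) := by
      rw [NF_rec, Finset.sum_mul]
      simp_rw [mul_assoc, ih']
      rw [← Finset.powerset_univ, Finset.sum_powerset_apply_card (fun j => S.card ^ j * (j * m ^ (m - j)))]
      have : n = S.card + m := by omega
      simp only [Finset.card_univ, hc, smul_eq_mul]
      rw [abel_sum m _ hm, ← this, mul_assoc]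
    have hp : n ^ m = n ^ (m - 1) * n := by rw [← pow_succ]; congr 1; omega
    calc _ = (NF V S * m) * n := by ring
      _ = _ := by rw [this, hp]; ring

def Trans {A : Type} (σ : Equiv.Perm A) : Prop := ∀ x y, ∃ t : ℕ, σ^[t] x = y

theorem card_trans (A : Type) [Fintype A] [Nonempty A] :
    Nat.card {σ : Equiv.Perm A // Trans σ} = (Fintype.card A - 1).factorial := by
  rcases Nat.lt_or_ge 1 (Fintype.card A) with h | h
  · have key : ∀ σ : Equiv.Perm A, Trans σ ↔ σ.cycleType = {Fintype.card A} := by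
      intro σ
      have : Nontrivial A := Fintype.one_lt_card_iff_nontrivial.1 h
      constructor
      · intro H
        have hne : ∀ x, σ x ≠ x := by
          intro x hx
          obtain ⟨y, hy⟩ := exists_ne x
          obtain ⟨t, ht⟩ := H x y
          rw [Function.iterate_fixed hx] at ht
          exact hy ht.symm
        have hc : σ.IsCycle := by
          obtain ⟨x⟩ := ‹Nonempty A›
          refine ⟨x, hne x, fun y _ => ?_⟩
          obtain ⟨t, ht⟩ := H x y
          exact ⟨t, by rw [zpow_natCast, ← Equiv.Perm.iterate_eq_pow]; exact ht⟩
        have hs : σ.support = Finset.univ := by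
          ext x; simp [hne x]
        rw [hc.cycleType, hs, Finset.card_univ]
      · intro H x y
        have hc : σ.IsCycle := by
          rw [← Equiv.Perm.card_cycleType_eq_one, H]; simp
        have hs : σ.support = Finset.univ := by
          rw [← Finset.card_eq_iff_eq_univ, ← Equiv.Perm.sum_cycleType, H]; simp
        have hne : ∀ x, σ x ≠ x := by
          intro x
          rw [← Equiv.Perm.mem_support, hs]; simp
        obtain ⟨t, ht⟩ := hc.exists_pow_eq (hne x) (hne y)
        exact ⟨t, by rw [Equiv.Perm.iterate_eq_pow]; exact ht⟩
    rw [Nat.card_congr (Equiv.subtypeEquivRight key), Nat.card_eq_fintype_card,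
      Fintype.card_subtype]
    have := Equiv.Perm.card_of_cycleType_mul_eq (α := A) {Fintype.card A}
    simp only [Multiset.sum_singleton, Multiset.prod_singleton, Multiset.mem_singleton, le_refl,
      forall_eq, true_and, Nat.sub_self, Nat.factorial_zero, one_mul, Multiset.toFinset_singleton,
      Finset.prod_singleton, Multiset.count_singleton_self, Nat.factorial_one, mul_one] at this
    rw [if_pos (by omega)] at this
    have h2 := Nat.mul_factorial_pred (n := Fintype.card A) (by omega)
    apply Nat.eq_of_mul_eq_mul_right (show 0 < Fintype.card A by omega)
    rw [mul_comm (Nat.factorial _), h2, ← this]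
  · have h1 : Fintype.card A - 1 = 0 := by omega
    rw [h1, Nat.factorial_zero, Nat.card_eq_one_iff_unique]
    have : Subsingleton A := Fintype.card_le_one_iff_subsingleton.1 h
    exact ⟨⟨fun a b => Subtype.ext (Subsingleton.elim _ _)⟩,
      ⟨⟨1, fun x y => ⟨0, Subsingleton.elim _ _⟩⟩⟩⟩

noncomputable def glue2 {V : Type} (S : Finset V) (σ : Equiv.Perm {v // v ∈ S})
    (g : {v // v ∉ S} → V) : V → V :=
  fun v => if hv : v ∈ S then (σ ⟨v, hv⟩ : V) else g ⟨v, hv⟩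

theorem glue2_iter {V : Type} (S : Finset V) (σ : Equiv.Perm {v // v ∈ S})
    (g : {v // v ∉ S} → V) (t : ℕ) (v : {v // v ∈ S}) :
    (glue2 S σ g)^[t] v = (σ^[t] v : {v // v ∈ S}) := by
  induction t generalizing v with
  | zero => rfl
  | succ t ih =>
    rw [Function.iterate_succ_apply, Function.iterate_succ_apply, ← ih]
    simp [glue2]

theorem glue2_reach {V : Type} (S : Finset V) (σ : Equiv.Perm {v // v ∈ S})
    (g : {v // v ∉ S} → V) (v : V) (h : Reach S g v) : ∃ t, (glue2 S σ g)^[t] v ∈ S := by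
  induction h with
  | base v h => exact ⟨0, h⟩
  | step v h _ ih =>
    obtain ⟨t, ht⟩ := ih
    refine ⟨t + 1, ?_⟩
    rw [Function.iterate_succ_apply]
    simpa [glue2, h] using ht

theorem reach_of_iter {V : Type} (S : Finset V) (f : V → V) (t : ℕ) (v : V)
    (h : f^[t] v ∈ S) : Reach S (fun v => f v.1) v := by
  induction t generalizing v with
  | zero => exact .base _ h
  | succ t ih =>
    by_cases hv : v ∈ S
    · exact .base _ hv
    · exact .step _ hv (ih _ h)

noncomputable def cyc {n : ℕ} (f : Fin n → Fin n) : Finset (Fin n) :=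
  Finset.univ.filter fun v => IsCyclic f v

theorem glue2_cyc {n : ℕ} (S : Finset (Fin n)) (σ : Equiv.Perm {v // v ∈ S}) (hσ : Trans σ)
    (g : {v // v ∉ S} → Fin n) (hg : ∀ v, Reach S g v) : cyc (glue2 S σ g) = S := by
  ext v
  simp only [cyc, Finset.mem_filter, Finset.mem_univ, true_and]
  constructor
  · rintro ⟨p, hp, hpv⟩
    obtain ⟨t, ht⟩ := glue2_reach S σ g v (hg v)
    have h1 : (glue2 S σ g)^[p * t] v = v := by
      rw [Function.iterate_mul]; exact Function.iterate_fixed hpv t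
    obtain ⟨r, hr⟩ : ∃ r, p * t = r + t := ⟨p * t - t, by
      have := Nat.le_mul_of_pos_left t hp; omega⟩
    rw [hr, Function.iterate_add_apply] at h1
    have := glue2_iter S σ g r ⟨_, ht⟩
    rw [h1] at this
    rw [this]; exact Subtype.property _
  · intro hv
    obtain ⟨t, ht⟩ := hσ (σ ⟨v, hv⟩) ⟨v, hv⟩
    refine ⟨t + 1, by omega, ?_⟩
    rw [glue2_iter S σ g (t+1) ⟨v, hv⟩, Function.iterate_succ_apply, ht]

theorem glue2_conn {n : ℕ} (S : Finset (Fin n)) (σ : Equiv.Perm {v // v ∈ S}) (hσ : Trans σ)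
    (g : {v // v ∉ S} → Fin n) (hg : ∀ v, Reach S g v) : Connected (glue2 S σ g) := by
  intro u v
  obtain ⟨s, hs⟩ := glue2_reach S σ g u (hg u)
  obtain ⟨t, ht⟩ := glue2_reach S σ g v (hg v)
  obtain ⟨r, hr⟩ := hσ ⟨_, hs⟩ ⟨_, ht⟩
  refine ⟨r + s, t, ?_⟩
  rw [Function.iterate_add_apply]
  have := glue2_iter S σ g r ⟨_, hs⟩
  rw [hr] at this
  exact this

theorem exists_iter_cyclic {n : ℕ} (f : Fin n → Fin n) (v : Fin n) :
    ∃ t, IsCyclic f (f^[t] v) := by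
  obtain ⟨i, j, hij, h⟩ := Finite.exists_ne_map_eq_of_infinite (fun t => f^[t] v)
  have key : ∀ i j : ℕ, i < j → f^[i] v = f^[j] v → ∃ t, IsCyclic f (f^[t] v) := by
    intro i j hij h
    refine ⟨i, j - i, by omega, ?_⟩
    rw [← Function.iterate_add_apply, Nat.sub_add_cancel hij.le]; exact h.symm
  rcases lt_or_gt_of_ne hij with h' | h'
  · exact key i j h' h
  · exact key j i h' h.symm

theorem conn_trans {n : ℕ} (f : Fin n → Fin n) (hf : Connected f) (u v : Fin n)
    (hv : IsCyclic f v) : ∃ t, f^[t] u = v := by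
  obtain ⟨s, t, h⟩ := hf u v
  obtain ⟨p, hp, hpv⟩ := hv
  have h1 : f^[p * t] v = v := by
    rw [Function.iterate_mul]; exact Function.iterate_fixed hpv t
  obtain ⟨r, hr⟩ : ∃ r, p * t = r + t := ⟨p * t - t, by
    have := Nat.le_mul_of_pos_left t hp; omega⟩
  rw [hr, Function.iterate_add_apply, ← h, ← Function.iterate_add_apply] at h1
  exact ⟨_, h1⟩

theorem conn_fiber {n : ℕ} (S : Finset (Fin n)) :
    Nat.card {f : {f : Fin n → Fin n // Connected f} // cyc f.1 = S}
      = Nat.card {σ : Equiv.Perm {v // v ∈ S} // Trans σ} * NF (Fin n) S := by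
  rw [NF, ← Nat.card_prod]
  symm
  apply Nat.card_eq_of_bijective (fun p => ⟨⟨glue2 S p.1.1 p.2.1,
    glue2_conn S p.1.1 p.1.2 p.2.1 p.2.2⟩, glue2_cyc S p.1.1 p.1.2 p.2.1 p.2.2⟩)
  constructor
  · rintro ⟨⟨a, ha⟩, h, hh⟩ ⟨⟨a', ha'⟩, h', hh'⟩ heq
    have heq' : glue2 S a h = glue2 S a' h' := congrArg (fun x => x.1.1) heq
    have h1 : a = a' := by
      ext ⟨v, hv⟩ : 1
      have := congrFun heq' v
      simp only [glue2, hv, dite_true] at this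
      exact Subtype.ext this
    have h2 : h = h' := by
      funext ⟨v, hv⟩
      have := congrFun heq' v
      simp only [glue2, hv, dite_false] at this
      exact this
    subst h1 h2; rfl
  · rintro ⟨⟨f, hf⟩, hS⟩
    have hm : ∀ v, v ∈ S ↔ IsCyclic f v := by
      intro v; rw [← hS]; simp [cyc]
    let e : {v // v ∈ S} ≃ {v : Fin n // IsCyclic f v} := Equiv.subtypeEquivRight hm
    let σ : Equiv.Perm {v // v ∈ S} := (e.trans (cyclicPerm f)).trans e.symm
    have hσ : ∀ v, (σ v : Fin n) = f v := fun v => rfl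
    have hgl : glue2 S σ (fun v => f v.1) = f := by
      funext v; by_cases hv : v ∈ S <;> simp [glue2, hv, hσ]
    refine ⟨(⟨σ, fun x y => ?_⟩, ⟨fun v => f v.1, fun v => ?_⟩), ?_⟩
    · obtain ⟨t, ht⟩ := conn_trans f hf x y ((hm _).1 y.2)
      refine ⟨t, Subtype.ext ?_⟩
      rw [← glue2_iter S σ (fun v => f v.1), hgl]; exact ht
    · obtain ⟨t, ht⟩ := exists_iter_cyclic f v
      exact reach_of_iter S f t v ((hm _).2 ht)
    · apply Subtype.ext; apply Subtype.ext; exact hgl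

theorem card_Un (n : ℕ) : (Un n).card = ∑ S : Finset (Fin n),
    Nat.card {σ : Equiv.Perm {v // v ∈ S} // Trans σ} * NF (Fin n) S := by
  have : (Un n).card = Nat.card {f : Fin n → Fin n // Connected f} := by
    rw [Nat.card_eq_fintype_card, Fintype.card_subtype, Un]
  rw [this, card_fibers (fun f : {f : Fin n → Fin n // Connected f} => cyc f.1)]
  exact Finset.sum_congr rfl fun S _ => conn_fiber S

/-- Rényi, exact form: the number of connected mappings. -/
theorem renyi_exact (n : ℕ) (hn : 0 < n) :
    ((Un n).card : ℝ) =
      ∑ k ∈ Finset.Icc 1 n,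
        (n.choose k : ℝ) * ((k - 1).factorial : ℝ) * (k : ℝ) *
          (n : ℝ) ^ ((n : ℤ) - 1 - (k : ℤ)) := by
  have hn0 : (n : ℝ) ≠ 0 := by positivity
  have hterm : ∀ S : Finset (Fin n),
      ((Nat.card {σ : Equiv.Perm {v // v ∈ S} // Trans σ} * NF (Fin n) S : ℕ) : ℝ) =
      ((S.card - 1).factorial : ℝ) * (S.card : ℝ) * (n : ℝ) ^ ((n : ℤ) - 1 - (S.card : ℤ)) := by
    intro S
    have h1 := NF_formula n (Fin n) S (by simp)
    have hle : S.card ≤ n := by simpa using S.card_le_univ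
    have h2 : (NF (Fin n) S : ℝ) = S.card * (n : ℝ) ^ ((n : ℤ) - 1 - (S.card : ℤ)) := by
      apply mul_right_cancel₀ hn0
      have e : (n : ℤ) - 1 - (S.card : ℤ) = ((n - S.card : ℕ) : ℤ) - 1 := by omega
      rw [e, zpow_sub_one₀ hn0, zpow_natCast, mul_assoc, inv_mul_cancel_right₀ hn0]
      exact_mod_cast h1
    rcases S.eq_empty_or_nonempty with rfl | hS
    · push_cast; rw [h2]; simp
    · have : Nonempty {v // v ∈ S} := hS.to_subtype
      rw [card_trans]; push_cast; rw [h2, Fintype.card_coe]; ring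
  rw [card_Un]
  rw [Nat.cast_sum]
  simp_rw [hterm]
  rw [← Finset.powerset_univ, Finset.sum_powerset_apply_card
    (fun j : ℕ => ((j - 1).factorial : ℝ) * (j : ℝ) * (n : ℝ) ^ ((n : ℤ) - 1 - (j : ℤ)))]
  rw [Finset.card_univ, Fintype.card_fin, Finset.range_eq_Ico, Finset.sum_eq_sum_Ico_succ_bot (by omega)]
  simp only [Nat.cast_zero, mul_zero, zero_mul, smul_zero, zero_add]
  refine Finset.sum_congr (by ext; simp) fun k _ => ?_
  rw [nsmul_eq_mul]; ring

end IterMap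
end

section
/- (Rényi) |U_n| = n^n · √(π/(2n)) · (1 + O(1/√n)) as n → ∞; that is, there is a constant C such that |U_n| / (n^n √(π/(2n))) = 1 + r_n with |r_n| ≤ C/√n for all sufficiently large n. -/
open scoped Classical
open Function

namespace IterMap

def Rch {n : ℕ} (S : Finset (Fin n)) (f : Fin n → Fin n) : Prop := ∀ u, ∃ t, f^[t] u ∈ S

def Ex {n : ℕ} (S : Finset (Fin n)) (f : Fin n → Fin n) (u b : Fin n) : Prop :=
  ∃ t, f^[t+1] u = b ∧ b ∈ S ∧ ∀ s < t, f^[s+1] u ∉ S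

noncomputable def NS {n : ℕ} (S : Finset (Fin n)) : Finset (Fin n → Fin n) :=
  Finset.univ.filter (Rch S)

theorem mem_NS {n : ℕ} {S : Finset (Fin n)} {f : Fin n → Fin n} : f ∈ NS S ↔ Rch S f := by
  simp [NS]

theorem Ex.unique {n : ℕ} {S : Finset (Fin n)} {f : Fin n → Fin n} {u b c : Fin n}
    (h1 : Ex S f u b) (h2 : Ex S f u c) : b = c := by
  obtain ⟨t, ht, hb, hs⟩ := h1
  obtain ⟨t', ht', hc, hs'⟩ := h2
  rcases lt_trichotomy t t' with h | h | h
  · exact absurd (ht ▸ hb) (hs' t h)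
  · subst h; rw [← ht, ← ht']
  · exact absurd (ht' ▸ hc) (hs t' h)

theorem Rch.ex {n : ℕ} {S : Finset (Fin n)} {f : Fin n → Fin n} (h : Rch S f) (u : Fin n) :
    ∃ b ∈ S, Ex S f u b := by
  have h' : ∃ t, f^[t+1] u ∈ S := by
    obtain ⟨t, ht⟩ := h (f u)
    exact ⟨t, by rwa [Function.iterate_succ_apply]⟩
  exact ⟨_, Nat.find_spec h', Nat.find h', rfl, Nat.find_spec h', fun s hs => Nat.find_min h' hs⟩

theorem rch_of_ex {n : ℕ} {S : Finset (Fin n)} {f : Fin n → Fin n}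
    (h : ∀ u, ∃ b, Ex S f u b) : Rch S f := by
  intro u
  obtain ⟨b, t, ht, hb, -⟩ := h u
  exact ⟨t+1, ht ▸ hb⟩

theorem Ex.swap {n : ℕ} {S : Finset (Fin n)} {f : Fin n → Fin n} {a b u c : Fin n}
    (ha : a ∈ S) (hb : b ∈ S) (h : Ex S f u c) :
    Ex S (Equiv.swap a b ∘ f) u (Equiv.swap a b c) := by
  obtain ⟨t, ht, hc, hs⟩ := h
  have hfix : ∀ v, v ∉ S → Equiv.swap a b v = v := fun v hv =>
    Equiv.swap_apply_of_ne_of_ne (fun h => hv (h ▸ ha)) (fun h => hv (h ▸ hb))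
  have key : ∀ s ≤ t, (Equiv.swap a b ∘ f)^[s+1] u = Equiv.swap a b (f^[s+1] u) := by
    intro s
    induction s with
    | zero => intro _; simp
    | succ s ih =>
      intro hst
      rw [Function.iterate_succ_apply', ih (by omega), hfix _ (hs s (by omega)),
        Function.iterate_succ_apply' f (s+1)]
      rfl
  have hmem : Equiv.swap a b c ∈ S := by
    rw [Equiv.swap_apply_def]; split_ifs <;> assumption
  refine ⟨t, by rw [key t le_rfl, ht], hmem, fun s hst => ?_⟩
  rw [key s hst.le, hfix _ (hs s hst)]
  exact hs s hst

theorem Rch.swap {n : ℕ} {S : Finset (Fin n)} {f : Fin n → Fin n} {a b : Fin n}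
    (ha : a ∈ S) (hb : b ∈ S) (h : Rch S f) : Rch S (Equiv.swap a b ∘ f) :=
  rch_of_ex fun u => by
    obtain ⟨c, -, hc⟩ := h.ex u
    exact ⟨_, hc.swap ha hb⟩

theorem card_CC {n : ℕ} {S : Finset (Fin n)} {a b : Fin n} (ha : a ∈ S) (hb : b ∈ S) :
    ((NS S).filter fun f => Ex S f a b).card = ((NS S).filter fun f => Ex S f a a).card := by
  have hinj : Function.Injective (fun f : Fin n → Fin n => Equiv.swap a b ∘ f) :=
    (Equiv.swap a b).injective.comp_left
  apply le_antisymm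
  · apply Finset.card_le_card_of_injOn (fun f => Equiv.swap a b ∘ f) _ hinj.injOn
    intro f hf
    simp only [Finset.coe_filter, Set.mem_ofPred_eq, mem_NS] at hf ⊢
    exact ⟨hf.1.swap ha hb, by simpa using hf.2.swap ha hb⟩
  · apply Finset.card_le_card_of_injOn (fun f => Equiv.swap a b ∘ f) _ hinj.injOn
    intro f hf
    simp only [Finset.coe_filter, Set.mem_ofPred_eq, mem_NS] at hf ⊢
    exact ⟨hf.1.swap ha hb, by simpa using hf.2.swap ha hb⟩

theorem card_NS_eq {n : ℕ} {S : Finset (Fin n)} {a : Fin n} (ha : a ∈ S) :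
    (NS S).card = S.card * ((NS S).filter fun f => Ex S f a a).card := by
  have h : NS S = S.biUnion fun b => (NS S).filter fun f => Ex S f a b := by
    ext f
    simp only [Finset.mem_biUnion, Finset.mem_filter, mem_NS]
    constructor
    · intro h
      obtain ⟨b, hb, hE⟩ := h.ex a
      exact ⟨b, hb, h, hE⟩
    · rintro ⟨b, hb, h, hE⟩; exact h
  conv_lhs => rw [h]
  rw [Finset.card_biUnion, Finset.sum_congr rfl (fun b hb => card_CC ha hb)]
  · simp
  · intro b hb c hc hbc
    rw [Function.onFun, Finset.disjoint_left]
    intro f hf hf'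
    simp only [Finset.mem_filter] at hf hf'
    exact hbc (hf.2.unique hf'.2)

theorem NS_erase {n : ℕ} {S : Finset (Fin n)} {a : Fin n} (ha : a ∈ S) :
    NS (S.erase a) = (NS S).filter fun f => ¬ Ex S f a a := by
  ext f
  simp only [Finset.mem_filter, mem_NS]
  constructor
  · intro h
    refine ⟨fun u => ?_, ?_⟩
    · obtain ⟨t, ht⟩ := h u
      exact ⟨t, Finset.mem_of_mem_erase ht⟩
    · rintro ⟨t, ht, -, hs⟩
      obtain ⟨m, hm⟩ := h a
      have hp : Function.IsPeriodicPt f (t+1) a := ht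
      rw [← hp.iterate_mod_apply] at hm
      have hlt : m % (t+1) < t+1 := Nat.mod_lt m (Nat.succ_pos t)
      rcases Nat.eq_zero_or_pos (m % (t+1)) with h0 | h0
      · rw [h0] at hm; simp at hm
      · obtain ⟨r, hr⟩ : ∃ r, m % (t+1) = r + 1 := ⟨m % (t+1) - 1, by omega⟩
        rw [hr] at hm
        exact hs r (by omega) (Finset.mem_of_mem_erase hm)
  · rintro ⟨h, hne⟩ u
    obtain ⟨c, hc, t, ht, -, -⟩ := h.ex u
    by_cases hca : c = a
    · obtain ⟨d, hd, hE⟩ := h.ex a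
      have hda : d ≠ a := fun e => hne (e ▸ hE)
      obtain ⟨s, hs, -, -⟩ := hE
      refine ⟨s+1+(t+1), ?_⟩
      rw [Function.iterate_add_apply, ht, hca, hs]
      exact Finset.mem_erase.2 ⟨hda, hd⟩
    · exact ⟨t+1, by rw [ht]; exact Finset.mem_erase.2 ⟨hca, hc⟩⟩

theorem card_NS {n : ℕ} (S : Finset (Fin n)) : n * (NS S).card = S.card * n ^ n := by
  suffices h : ∀ A : Finset (Fin n), n * (NS Aᶜ).card = (Aᶜ).card * n ^ n by
    simpa using h Sᶜ
  intro A
  induction A using Finset.induction_on with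
  | empty =>
    have : NS (∅ : Finset (Fin n))ᶜ = Finset.univ := by
      ext f; simp only [mem_NS, Finset.mem_univ, iff_true]
      intro u; exact ⟨0, by simp⟩
    rw [this]; simp
  | insert a A haA ih =>
    have ha : a ∈ Aᶜ := by simpa using haA
    rw [Finset.compl_insert, NS_erase ha, Finset.card_erase_of_mem ha]
    have h1 := card_NS_eq ha
    have h2 := Finset.card_filter_add_card_filter_not (s := NS Aᶜ) (fun f => Ex Aᶜ f a a)
    have hpos : 0 < (Aᶜ).card := Finset.card_pos.2 ⟨a, ha⟩
    set X := ((NS Aᶜ).filter fun f => Ex Aᶜ f a a).card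
    set Y := ((NS Aᶜ).filter fun f => ¬ Ex Aᶜ f a a).card
    obtain ⟨p, hp⟩ : ∃ p, (Aᶜ).card = p + 1 := ⟨(Aᶜ).card - 1, by omega⟩
    rw [hp] at ih h1 ⊢
    have h3 : n * X = n ^ n := by
      have : (p+1) * (n * X) = (p+1) * n ^ n := by rw [← ih, h1]; ring
      exact Nat.eq_of_mul_eq_mul_left (Nat.succ_pos p) this
    have h4 : Y = p * X := by
      have : (p+1) * X = p * X + X := by ring
      omega
    rw [h4, Nat.add_sub_cancel, ← h3]; ring

theorem Rch.congr {n : ℕ} {S : Finset (Fin n)} {f f' : Fin n → Fin n} (h : Rch S f)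
    (hff : ∀ v, v ∉ S → f' v = f v) : Rch S f' := by
  intro u
  obtain ⟨t, ht⟩ := h u
  induction t generalizing u with
  | zero => exact ⟨0, ht⟩
  | succ t ih =>
    by_cases hu : u ∈ S
    · exact ⟨0, hu⟩
    · rw [Function.iterate_succ_apply, ← hff u hu] at ht
      obtain ⟨s, hs⟩ := ih _ ht
      exact ⟨s+1, by rwa [Function.iterate_succ_apply]⟩

theorem card_fiber_le {n : ℕ} (S : Finset (Fin n)) (g h : S → Fin n) :
    ((NS S).filter fun f => (fun v : S => f v) = g).card ≤
      ((NS S).filter fun f => (fun v : S => f v) = h).card := by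
  apply Finset.card_le_card_of_injOn (fun f v => if hv : v ∈ S then h ⟨v, hv⟩ else f v)
  · intro f hf
    simp only [Finset.coe_filter, Set.mem_ofPred_eq, mem_NS] at hf ⊢
    refine ⟨hf.1.congr fun v hv => by simp [hv], ?_⟩
    funext v; simp
  · intro f hf f' hf' e
    simp only [Finset.coe_filter, Set.mem_ofPred_eq, mem_NS] at hf hf'
    funext v
    by_cases hv : v ∈ S
    · exact congrFun (hf.2.trans hf'.2.symm) ⟨v, hv⟩
    · simpa [hv] using congrFun e v

theorem card_fiber {n : ℕ} (S : Finset (Fin n)) (g : S → Fin n) :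
    n ^ S.card * ((NS S).filter fun f => (fun v : S => f v) = g).card = (NS S).card := by
  rw [Finset.card_eq_sum_card_fiberwise (f := fun f (v : S) => f v) (t := Finset.univ)
    (s := NS S) (by intro _ _; simp)]
  rw [Finset.sum_congr rfl (fun h _ => le_antisymm (card_fiber_le S h g) (card_fiber_le S g h))]
  simp

noncomputable def DD {n k : ℕ} (x : Fin (k+1) ↪ Fin n) : Finset (Fin n → Fin n) :=
  Finset.univ.filter fun f => Rch (Finset.univ.map x) f ∧ ∀ i, f (x i) = x (i + 1)

theorem card_DD {n k : ℕ} (x : Fin (k+1) ↪ Fin n) :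
    n * (n ^ (k+1) * (DD x).card) = (k+1) * n ^ n := by
  have h := card_fiber (Finset.univ.map x)
    (fun v => Function.extend x (fun i => x (i+1)) id v.1)
  have h2 := card_NS (Finset.univ.map x)
  rw [Finset.card_map, Finset.card_univ, Fintype.card_fin] at h h2
  rw [← h2, ← h]
  congr 3
  ext f
  simp only [DD, Finset.mem_filter, mem_NS, Finset.mem_univ, true_and]
  refine and_congr_right fun _ => ⟨fun h => ?_, fun h i => ?_⟩
  · funext ⟨v, hv⟩
    obtain ⟨i, -, rfl⟩ := Finset.mem_map.1 hv
    simp only [x.injective.extend_apply, h]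
  · have := congrFun h ⟨x i, by simp⟩
    simpa only [x.injective.extend_apply] using this

open scoped Fin.NatCast Fin.CommRing in
theorem DD_iter {n k : ℕ} {x : Fin (k+1) ↪ Fin n} {f : Fin n → Fin n}
    (h : ∀ i, f (x i) = x (i + 1)) (t : ℕ) (i : Fin (k+1)): f^[t] (x i) = x (i + (t : Fin (k+1))) := by
  induction t with
  | zero => simp
  | succ t ih => rw [Function.iterate_succ_apply', ih, h]; push_cast; rw [add_assoc]

open scoped Fin.NatCast Fin.CommRing in
theorem DD_period {n k : ℕ} {x : Fin (k+1) ↪ Fin n} {f : Fin n → Fin n}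
    (h : ∀ i, f (x i) = x (i + 1)) : Function.minimalPeriod f (x 0) = k + 1 := by
  have h1 : Function.IsPeriodicPt f (k+1) (x 0) := by
    show f^[k+1] (x 0) = x 0
    rw [DD_iter h]; simp
  refine Nat.dvd_antisymm h1.minimalPeriod_dvd ?_
  have h2 := Function.isPeriodicPt_minimalPeriod f (x 0)
  have h3 : f^[Function.minimalPeriod f (x 0)] (x 0) = x 0 := h2
  rw [DD_iter h] at h3
  have := x.injective h3
  rw [zero_add] at this
  exact (Fin.natCast_eq_zero).1 this

open scoped Fin.NatCast Fin.CommRing in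
theorem DD_connected {n k : ℕ} {x : Fin (k+1) ↪ Fin n} {f : Fin n → Fin n}
    (h : f ∈ DD x) : Connected f ∧ ∀ u, ∃ t, f^[t] u = x 0 := by
  simp only [DD, Finset.mem_filter, Finset.mem_univ, true_and] at h
  have key : ∀ u, ∃ t, f^[t] u = x 0 := by
    intro u
    obtain ⟨t, ht⟩ := h.1 u
    obtain ⟨i, -, hi⟩ := Finset.mem_map.1 ht
    refine ⟨((-i : Fin (k+1)) : ℕ) + t, ?_⟩
    rw [Function.iterate_add_apply, ← hi, DD_iter h.2]
    simp
  refine ⟨fun u v => ?_, key⟩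
  obtain ⟨s, hs⟩ := key u
  obtain ⟨t, ht⟩ := key v
  exact ⟨s, t, hs.trans ht.symm⟩

theorem exists_periodic {n : ℕ} (hn : 0 < n) (f : Fin n → Fin n) :
    ∃ w, w ∈ Function.periodicPts f := by
  obtain ⟨a, b, hab, h⟩ := Finite.exists_ne_map_eq_of_infinite (fun t : ℕ => f^[t] (⟨0, hn⟩ : Fin n))
  wlog hlt : a < b generalizing a b
  · exact this b a hab.symm h.symm (by omega)
  refine ⟨f^[a] ⟨0, hn⟩, Function.mk_mem_periodicPts (n := b - a) (by omega) ?_⟩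
  show f^[b-a] _ = _
  rw [← Function.iterate_add_apply, Nat.sub_add_cancel hlt.le]
  exact h.symm

theorem conn_periodic {n : ℕ} {f : Fin n → Fin n} (hf : Connected f) {w v : Fin n}
    (hw : w ∈ Function.periodicPts f) (hv : v ∈ Function.periodicPts f) :
    ∃ j < Function.minimalPeriod f w, v = f^[j] w := by
  obtain ⟨s, t, hst⟩ := hf w v
  obtain ⟨q, hq, hqv⟩ := hv
  have h1 : f^[t * q] v = v := by
    rw [mul_comm]; exact (hqv.mul_const t)
  have h2 : f^[t * q - t + s] w = v := by
    rw [Function.iterate_add_apply, hst, ← Function.iterate_add_apply,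
      Nat.sub_add_cancel (Nat.le_mul_of_pos_right t hq), h1]
  refine ⟨(t * q - t + s) % Function.minimalPeriod f w,
    Nat.mod_lt _ (Function.minimalPeriod_pos_of_mem_periodicPts hw), ?_⟩
  rw [Function.iterate_mod_minimalPeriod_eq, h2]

open scoped Fin.NatCast Fin.CommRing in
theorem fiber_conn {n k : ℕ} {f : Fin n → Fin n} (hf : Connected f) {w : Fin n}
    (hw : w ∈ Function.periodicPts f) :
    (Finset.univ.filter fun x : Fin (k+1) ↪ Fin n => f ∈ DD x).card =
      if k + 1 = Function.minimalPeriod f w then k + 1 else 0 := by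
  have hx0 : ∀ x : Fin (k+1) ↪ Fin n, f ∈ DD x → 
      ∃ j < Function.minimalPeriod f w, x 0 = f^[j] w := by
    intro x hx
    have h := hx
    simp only [DD, Finset.mem_filter, Finset.mem_univ, true_and] at h
    apply conn_periodic hf hw
    rw [← Function.minimalPeriod_pos_iff_mem_periodicPts, DD_period h.2]
    omega
  split_ifs with hk
  · have hinj : ∀ a b, a < k + 1 → b < k + 1 → f^[a] w = f^[b] w → a = b := by
      intro a b ha hb hab
      rw [hk] at ha hb
      exact Function.iterate_injOn_Iio_minimalPeriod ha hb hab
    have hper : f^[k+1] w = w := by rw [hk]; exact Function.isPeriodicPt_minimalPeriod f w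
    have hreach : ∀ u, ∃ t, f^[t] u = w := by
      intro u
      obtain ⟨s, t, hst⟩ := hf u w
      refine ⟨(t * (k+1) - t) + s, ?_⟩
      rw [Function.iterate_add_apply, hst, ← Function.iterate_add_apply,
        Nat.sub_add_cancel (Nat.le_mul_of_pos_right t (Nat.succ_pos k)), mul_comm,
        Function.iterate_mul]
      exact Function.iterate_fixed hper t
    have hmod : ∀ t, f^[t % (k+1)] w = f^[t] w := by
      intro t; rw [hk]; exact Function.iterate_mod_minimalPeriod_eq
    let E : Fin (k+1) → (Fin (k+1) ↪ Fin n) := fun j =>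
      ⟨fun i => f^[((i + j : Fin (k+1)) : ℕ)] w, fun a b hab => by
        have := hinj _ _ (Fin.is_lt _) (Fin.is_lt _) hab
        exact add_right_cancel (Fin.ext this)⟩
    have hEapp : ∀ j i, E j i = f^[((i + j : Fin (k+1)) : ℕ)] w := fun _ _ => rfl
    have hEs : ∀ j i, f (E j i) = E j (i+1) := by
      intro j i
      rw [hEapp, hEapp, ← Function.iterate_succ_apply' f, ← hmod]
      have h1 : (i + 1 + j : Fin (k+1)) = (i + j) + 1 := by ring
      rw [h1, Fin.val_add (i+j) 1, Fin.val_one', Nat.add_mod_mod]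
    have hE : ∀ j, f ∈ DD (E j) := by
      intro j
      simp only [DD, Finset.mem_filter, Finset.mem_univ, true_and]
      refine ⟨fun u => ?_, hEs j⟩
      obtain ⟨t, ht⟩ := hreach u
      refine ⟨t, Finset.mem_map.2 ⟨-j, Finset.mem_univ _, ?_⟩⟩
      rw [hEapp, ht]; simp
    refine Eq.trans (Eq.symm ?_) (Fintype.card_fin (k+1))
    rw [← Finset.card_univ]
    apply Finset.card_bij (fun j _ => E j)
    · intro j _; simpa using hE j
    · intro a _ b _ hab
      have := DFunLike.congr_fun hab 0
      rw [hEapp, hEapp, zero_add, zero_add] at this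
      exact Fin.ext (hinj _ _ a.2 b.2 this)
    · intro x hx
      have hx := (Finset.mem_filter.1 hx).2
      obtain ⟨j, hj, hxj⟩ := hx0 x hx
      rw [← hk] at hj
      refine ⟨⟨j, hj⟩, Finset.mem_univ _, ?_⟩
      simp only [DD, Finset.mem_filter, Finset.mem_univ, true_and] at hx
      ext1 i
      have h1 := DD_iter hx.2 i 0
      have h2 := DD_iter (hEs ⟨j, hj⟩) i 0
      have h0 : E ⟨j, hj⟩ 0 = x 0 := by rw [hEapp, zero_add, hxj]
      rw [h0, h1] at h2
      simpa using h2.symm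
  · rw [Finset.card_eq_zero, Finset.filter_eq_empty_iff]
    intro x _ hx
    obtain ⟨j, hj, hxj⟩ := hx0 x hx
    simp only [DD, Finset.mem_filter, Finset.mem_univ, true_and] at hx
    apply hk
    rw [← DD_period hx.2, hxj, Function.minimalPeriod_apply_iterate hw]

theorem weight {n : ℕ} (hn : 0 < n) (f : Fin n → Fin n) :
    ∑ k ∈ Finset.range n, (1 / ((k:ℝ)+1)) *
      ((Finset.univ.filter fun x : Fin (k+1) ↪ Fin n => f ∈ DD x).card : ℝ) =
      if Connected f then 1 else 0 := by
  split_ifs with hf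
  · obtain ⟨w, hw⟩ := exists_periodic hn f
    have hp := Function.minimalPeriod_pos_of_mem_periodicPts hw
    have hle : Function.minimalPeriod f w ≤ n := by
      have := Finset.card_le_card_of_injOn (s := Finset.range (Function.minimalPeriod f w))
        (t := (Finset.univ : Finset (Fin n))) (fun t => f^[t] w) (by intro _ _; simp)
        (by rw [Finset.coe_range]; exact Function.iterate_injOn_Iio_minimalPeriod)
      simpa using this
    rw [Finset.sum_eq_single (Function.minimalPeriod f w - 1)]
    · rw [fiber_conn hf hw, if_pos (by omega)]
      push_cast
      field_simp
    · intro k _ hk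
      rw [fiber_conn hf hw, if_neg (by omega)]; simp
    · intro h; exact absurd (Finset.mem_range.2 (by omega)) h
  · apply Finset.sum_eq_zero
    intro k _
    rw [Finset.filter_false_of_mem (fun x _ hx => hf (DD_connected hx).1)]
    simp

theorem card_Un_s7 {n : ℕ} (hn : 0 < n) :
    ((Un n).card : ℝ) * n = (n:ℝ)^n * ∑ k ∈ Finset.range n, (n.descFactorial (k+1) : ℝ) / (n:ℝ)^(k+1) := by
  have hn0 : (n:ℝ) ≠ 0 := by positivity
  have h1 : ((Un n).card : ℝ) = ∑ f : Fin n → Fin n, if Connected f then (1:ℝ) else 0 := by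
    rw [Un, Finset.card_filter]; push_cast; rfl
  rw [h1, Finset.sum_congr rfl (fun f _ => (weight hn f).symm), Finset.sum_comm, Finset.sum_mul,
    Finset.mul_sum]
  refine Finset.sum_congr rfl fun k _ => ?_
  rw [← Finset.mul_sum]
  have h2 : ∑ f : Fin n → Fin n, 
      ((Finset.univ.filter fun x : Fin (k+1) ↪ Fin n => f ∈ DD x).card : ℝ) =
      ∑ x : Fin (k+1) ↪ Fin n, ((DD x).card : ℝ) := by
    have : ∀ f : Fin n → Fin n, ((Finset.univ.filter fun x : Fin (k+1) ↪ Fin n => f ∈ DD x).card : ℝ)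
      = ∑ x : Fin (k+1) ↪ Fin n, if f ∈ DD x then (1:ℝ) else 0 := by
      intro f; rw [Finset.card_filter]; push_cast; rfl
    simp_rw [this]
    rw [Finset.sum_comm]
    refine Finset.sum_congr rfl fun x _ => ?_
    simp
  have h3 : ∀ x : Fin (k+1) ↪ Fin n, ((DD x).card : ℝ) = (k+1) * (n:ℝ)^n / (n * n^(k+1)) := by
    intro x
    have : (n:ℝ) * ((n:ℝ) ^ (k+1) * (DD x).card) = (k+1) * (n:ℝ) ^ n := by
      exact_mod_cast card_DD x
    rw [← this]; field_simp
  rw [h2, Finset.sum_congr rfl (fun x _ => h3 x)]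
  simp only [Finset.sum_const, Finset.card_univ, Fintype.card_embedding_eq, Fintype.card_fin,
    nsmul_eq_mul]
  field_simp

noncomputable def QQ (n : ℕ) : ℝ := ∑ k ∈ Finset.range n, (n.descFactorial (k+1) : ℝ) / (n:ℝ)^(k+1)

theorem gauss_val {n : ℕ} (hn : 0 < n) :
    ∫ x in Set.Ioi (0:ℝ), Real.exp (-(1/(2*(n:ℝ))) * x^2) = Real.sqrt (Real.pi * n / 2) := by
  have hn' : (0:ℝ) < n := by exact_mod_cast hn
  rw [integral_gaussian_Ioi]
  have : Real.pi / (1/(2*(n:ℝ))) = 4 * (Real.pi * n / 2) := by field_simp; ring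
  rw [this, Real.sqrt_mul (by norm_num), show (4:ℝ) = 2^2 by norm_num, Real.sqrt_sq (by norm_num)]
  ring

theorem desc_le {n : ℕ} (hn : 0 < n) (k : ℕ) (hk : k < n) :
    (n.descFactorial (k+1) : ℝ) / (n:ℝ)^(k+1) ≤ Real.exp (-(1/(2*(n:ℝ))) * (k:ℝ)^2) := by
  have hn' : (0:ℝ) < n := by exact_mod_cast hn
  induction k with
  | zero => simp [hn'.ne']
  | succ k ih =>
    have ih := ih (by omega)
    rw [Nat.descFactorial_succ, Nat.cast_mul, Nat.cast_sub hk.le, pow_succ]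
    have e : ((n:ℝ) - ((k+1:ℕ):ℝ)) * (n.descFactorial (k+1) : ℝ) / ((n:ℝ)^(k+1) * n) =
      (1 - (k+1)/n) * ((n.descFactorial (k+1) : ℝ) / (n:ℝ)^(k+1)) := by
      push_cast; field_simp
    rw [e]
    have h1 : 1 - ((k:ℝ)+1)/n ≤ Real.exp (-((k+1)/n)) := by
      have := Real.add_one_le_exp (-(((k:ℝ)+1)/n)); linarith
    calc _ ≤ Real.exp (-((k+1)/n)) * Real.exp (-(1/(2*(n:ℝ))) * (k:ℝ)^2) := by
          apply mul_le_mul h1 ih (by positivity) (by positivity)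
      _ ≤ _ := by
          rw [← Real.exp_add]
          apply Real.exp_le_exp.2
          push_cast
          have : -(1/(2*(n:ℝ))) * ((k:ℝ)+1)^2 - (-((k+1)/n) + -(1/(2*(n:ℝ))) * (k:ℝ)^2)
            = 1/(2*n) := by field_simp; ring
          have h2 : (0:ℝ) < 1/(2*n) := by positivity
          linarith

theorem QQ_upper {n : ℕ} (hn : 0 < n) : QQ n ≤ Real.sqrt (Real.pi * n / 2) + 1 := by
  have hn' : (0:ℝ) < n := by exact_mod_cast hn
  set g : ℝ → ℝ := fun x => Real.exp (-(1/(2*(n:ℝ))) * x^2) with hg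
  have hanti : AntitoneOn g (Set.Icc (0:ℝ) (0 + (n:ℕ))) := by
    intro x hx y hy hxy
    apply Real.exp_le_exp.2
    have : x^2 ≤ y^2 := by have := hx.1; gcongr
    have h2 : (0:ℝ) < 1/(2*n) := by positivity
    nlinarith
  have h1 := hanti.sum_le_integral
  have h2 : QQ n ≤ ∑ k ∈ Finset.range n, g k := by
    apply Finset.sum_le_sum
    intro k hk
    exact desc_le hn k (Finset.mem_range.1 hk)
  have h3 : ∑ k ∈ Finset.range n, g k ≤ ∑ k ∈ Finset.range (n+1), g k :=
    Finset.sum_le_sum_of_subset_of_nonneg (Finset.range_mono (by omega))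
      (fun _ _ _ => (Real.exp_pos _).le)
  rw [Finset.sum_range_succ'] at h3
  have h4 : g ((0:ℕ):ℝ) = 1 := by simp [hg]
  have h5 : ∫ x in (0:ℝ)..(0 + (n:ℕ)), g x ≤ ∫ x in Set.Ioi (0:ℝ), g x := by
    rw [intervalIntegral.integral_of_le (by positivity)]
    apply MeasureTheory.setIntegral_mono_set
    · exact (integrable_exp_neg_mul_sq (by positivity : (0:ℝ) < 1/(2*n))).integrableOn
    · exact Filter.Eventually.of_forall fun _ => (Real.exp_pos _).le
    · exact (Set.Ioc_subset_Ioi_self).eventuallyLE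
  rw [gauss_val hn] at h5
  simp only [zero_add] at h1 h5
  linarith

theorem int_pow (k : ℕ) : MeasureTheory.IntegrableOn (fun x : ℝ => Real.exp (-x) * x^k) (Set.Ioi 0) ∧
    ∫ x in Set.Ioi (0:ℝ), Real.exp (-x) * x^k = k.factorial := by
  constructor
  · have := Real.GammaIntegral_convergent (s := k+1) (by positivity)
    simpa using this
  · have := Real.Gamma_eq_integral (s := k+1) (by positivity)
    rw [Real.Gamma_nat_eq_factorial] at this
    simpa using this.symm

theorem expand {n : ℕ} (hn : 0 < n) (x : ℝ) : Real.exp (-x) * (x / n + 1)^n =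
    ∑ k ∈ Finset.range (n+1), ((n.choose k : ℝ) / (n:ℝ)^k) * (Real.exp (-x) * x^k) := by
  rw [add_pow, Finset.mul_sum]
  refine Finset.sum_congr rfl fun k _ => ?_
  rw [div_pow, one_pow]; ring

theorem QQ_int {n : ℕ} (hn : 0 < n) :
    MeasureTheory.IntegrableOn (fun x : ℝ => Real.exp (-x) * (x / n + 1)^n) (Set.Ioi 0) ∧
    ∫ x in Set.Ioi (0:ℝ), Real.exp (-x) * (x / n + 1)^n = QQ n + 1 := by
  simp_rw [expand hn]
  constructor
  · exact MeasureTheory.integrable_finsetSum _ fun k _ => (int_pow k).1.const_mul _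
  · rw [MeasureTheory.integral_finsetSum _ fun k _ => (int_pow k).1.const_mul _]
    simp_rw [MeasureTheory.integral_const_mul, (int_pow _).2]
    rw [Finset.sum_range_succ', QQ]
    simp only [Nat.choose_zero_right, Nat.cast_one, pow_zero, div_one, Nat.factorial_zero, mul_one]
    congr 1
    refine Finset.sum_congr rfl fun k _ => ?_
    rw [Nat.descFactorial_eq_factorial_mul_choose]
    push_cast; ring

theorem QQ_lower {n : ℕ} (hn : 0 < n) : Real.sqrt (Real.pi * n / 2) ≤ QQ n + 1 := by
  have hn' : (0:ℝ) < n := by exact_mod_cast hn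
  rw [← gauss_val hn, ← (QQ_int hn).2]
  apply MeasureTheory.setIntegral_mono_on
    (integrable_exp_neg_mul_sq (by positivity : (0:ℝ) < 1/(2*n))).integrableOn (QQ_int hn).1
    measurableSet_Ioi
  intro x hx
  have hx : 0 < x := hx
  have ht : 0 < x / n := by positivity
  have h1 := Real.le_log_one_add_of_nonneg ht.le
  have h2 : x/n - (x/n)^2/2 ≤ 2*(x/n)/(x/n+2) := by
    rw [le_div_iff₀ (by positivity)]
    nlinarith [pow_pos ht 3]
  have h3 : (x/n+1)^n = Real.exp (n * Real.log (1 + x/n)) := by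
    rw [mul_comm, Real.exp_mul, Real.exp_log (by positivity), Real.rpow_natCast, add_comm]
  rw [h3, ← Real.exp_add]
  apply Real.exp_le_exp.2
  have h4 : n * (x/n - (x/n)^2/2) ≤ n * Real.log (1+x/n) := by gcongr; linarith
  have h5 : n * (x/n - (x/n)^2/2) = x + -(1/(2*(n:ℝ))) * x^2 := by field_simp; ring
  linarith

theorem final (u : ℕ → ℝ) (hu : ∀ n, 0 < n → u n * n = (n:ℝ)^n * QQ n) :
    ∃ C : ℝ, ∃ N : ℕ, ∀ n : ℕ, N ≤ n →
      |u n / ((n : ℝ) ^ n * Real.sqrt (Real.pi / (2 * n))) - 1| ≤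
        C / Real.sqrt n := by
  refine ⟨1, 1, fun n hn => ?_⟩
  have hn' : (0:ℝ) < n := by exact_mod_cast hn
  have e0 : Real.sqrt (Real.pi * n / 2) = n * Real.sqrt (Real.pi / (2*n)) := by
    rw [show Real.pi * n / 2 = (n:ℝ)^2 * (Real.pi / (2*n)) by field_simp, Real.sqrt_mul (by positivity),
      Real.sqrt_sq hn'.le]
  have hs : 0 < Real.sqrt (Real.pi / (2*n)) := Real.sqrt_pos.2 (by positivity)
  have hs2 : 0 < Real.sqrt (Real.pi * n / 2) := Real.sqrt_pos.2 (by positivity)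
  have e1 : u n / ((n : ℝ) ^ n * Real.sqrt (Real.pi / (2 * n))) - 1 =
      (QQ n - Real.sqrt (Real.pi * n / 2)) / Real.sqrt (Real.pi * n / 2) := by
    have : u n = (n:ℝ)^n * QQ n / n := by rw [← hu n hn]; field_simp
    rw [this, sub_div, div_self hs2.ne', e0]
    field_simp
  rw [e1, abs_div, abs_of_pos hs2]
  have h1 := QQ_lower hn
  have h2 := QQ_upper hn
  have h3 : |QQ n - Real.sqrt (Real.pi * n / 2)| ≤ 1 := abs_le.2 ⟨by linarith, by linarith⟩
  apply div_le_div₀ zero_le_one h3 (Real.sqrt_pos.2 hn')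
  apply Real.sqrt_le_sqrt
  nlinarith [Real.pi_gt_three]
/-- Rényi: `|U_n| = n^n √(π/(2n)) (1 + O(1/√n))`. -/
theorem renyi_card_asymp :
    ∃ C : ℝ, ∃ N : ℕ, ∀ n : ℕ, N ≤ n →
      |((Un n).card : ℝ) / ((n : ℝ) ^ n * Real.sqrt (Real.pi / (2 * n))) - 1| ≤
        C / Real.sqrt n := by
  exact final (fun n => ((Un n).card : ℝ)) fun n hn => card_Un_s7 hn

end IterMap
end
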